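/- Let σ > 0 and ε₀ > 0. There exists a constant C = C(ε₀, σ) > 0 such that for every s ≤ 0, every integer k ≥ 0, and every Schwartz function u : ℝ → ℂ whose Fourier transform is supported in [ε₀, ∞), one has ‖ u · (∂ₓ⁻¹(u u*))^k ‖_{E^s_σ} ≤ C^k ‖u‖^{2k+1}_{E^s_σ}. -/

import Mathlib

open MeasureTheory Real FourierTransform

/-- The `E^s_σ` norm of `f : ℝ → ℂ`:
`‖f‖_{E^s_σ} = (∫ ⟨ξ⟩^{2σ} 2^{2s|ξ|} |𝓕f(ξ)|² dξ)^{1/2}`, with `⟨ξ⟩^{2σ} = (1+ξ²)^σ`. -/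
noncomputable def Enorm (s σ : ℝ) (f : ℝ → ℂ) : ℝ :=
  (∫ ξ : ℝ, (1 + ξ ^ 2) ^ σ * (2 : ℝ) ^ (2 * s * |ξ|) * ‖𝓕 f ξ‖ ^ 2) ^ (1 / 2 : ℝ)

/-- The antiderivative `∂ₓ⁻¹ f (x) = ½(∫_{-∞}^x f − ∫_x^∞ f)`. -/
noncomputable def pinv (f : ℝ → ℂ) (x : ℝ) : ℂ :=
  (1 / 2 : ℂ) * ((∫ y in Set.Iic x, f y) - ∫ y in Set.Ici x, f y)

open Filter Topology Set
open scoped ENNReal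

/-- The Fourier transform of `φ * 𝓕⁻ h` is the convolution of `h` with `𝓕 φ`. -/
theorem fourier_mul_fourierInv {φ h : ℝ → ℂ} (hφ : Integrable φ) (hh : Integrable h) (ξ : ℝ) :
    𝓕 (fun x => φ x * 𝓕⁻ h x) ξ = ∫ η, h η * 𝓕 φ (ξ - η) := by
  set ψ : ℝ → ℂ := fun x => 𝐞 (x * ξ) • φ (-x) with hψ
  have hψi : Integrable ψ := by
    have h1 := (Real.fourierIntegral_convergent_iff (V := ℝ) (μ := volume)
      (f := fun x => φ (-x)) (-ξ)).2 hφ.comp_neg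
    refine h1.congr (Eventually.of_forall fun x => ?_)
    simp [hψ, mul_comm]
  have key := VectorFourier.integral_fourierIntegral_smul_eq_flip (μ := volume) (ν := volume)
    (L := innerₗ ℝ) (f := h) (g := ψ) Real.continuous_fourierChar continuous_inner hh hψi
  have hψF : ∀ η, 𝓕 ψ η = 𝓕 φ (ξ - η) := by
    intro η
    rw [Real.fourier_real_eq, Real.fourier_real_eq,
      ← integral_neg_eq_self (fun v => 𝐞 (-(v * (ξ - η))) • φ v)]
    refine integral_congr_ae (Eventually.of_forall fun x => ?_)
    simp only [hψ, smul_smul, ← AddChar.map_add_eq_mul]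
    ring_nf
  have hflip : ∀ η, VectorFourier.fourierIntegral 𝐞 volume (innerₗ ℝ).flip ψ η = 𝓕 ψ η := by
    intro η
    rw [Real.fourier_real_eq]
    simp [VectorFourier.fourierIntegral, mul_comm]
  simp only [hflip, hψF, smul_eq_mul] at key
  rw [← key, Real.fourier_real_eq,
    ← integral_neg_eq_self (fun v => 𝐞 (-(v * ξ)) • (φ v * 𝓕⁻ h v))]
  refine integral_congr_ae (Eventually.of_forall fun x => ?_)
  have : 𝓕⁻ h (-x) = 𝓕 h x := by rw [Real.fourierInv_eq_fourier_neg, neg_neg]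
  simp only [hψ, this, neg_mul, neg_neg, Circle.smul_def, smul_eq_mul]
  change _ = 𝓕 h x * _
  ring

theorem tendsto_fourierInv_atBot (h : ℝ → ℂ) : Tendsto (𝓕⁻ h) atBot (𝓝 0) := by
  rw [Real.fourierInv_eq_fourier_comp_neg]
  exact (Real.zero_at_infty_fourier _).mono_left atBot_le_cocompact

theorem hasDerivAt_fourierInv {h : ℝ → ℂ} (hh : Integrable h)
    (hh' : Integrable fun x : ℝ => x • h x) (w : ℝ) :
    HasDerivAt (𝓕⁻ h) (𝓕⁻ (fun x : ℝ => (2 * π * Complex.I * x) * h x) w) w := by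
  have h1 := Real.hasDerivAt_fourier (f := fun x => h (-x)) hh.comp_neg
    (by simpa using hh'.comp_neg.neg) w
  have h2 : (fun x : ℝ => (-2 * π * Complex.I * x) • h (-x)) =
      fun x : ℝ => (2 * π * Complex.I * ((-x : ℝ) : ℂ)) * h (-x) := by
    ext x
    push_cast [smul_eq_mul]
    ring
  rw [h2] at h1
  rwa [Real.fourierInv_eq_fourier_comp_neg, Real.fourierInv_eq_fourier_comp_neg]

/-- If `𝓕 g` vanishes to the left of some `ε > 0`, then `∂ₓ⁻¹` acts on `g` as the Fourier multiplier
`1 / (2πiξ)`. -/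
theorem pinv_eq_fourierInv {g : ℝ → ℂ} (hc : Continuous g) (hg : Integrable g)
    (hG : Integrable (𝓕 g)) {ε : ℝ} (hε : 0 < ε) (hsupp : ∀ ξ < ε, 𝓕 g ξ = 0) :
    Integrable (fun ξ : ℝ => 𝓕 g ξ / (2 * π * Complex.I * ξ)) ∧
      pinv g = 𝓕⁻ (fun ξ : ℝ => 𝓕 g ξ / (2 * π * Complex.I * ξ)) := by
  set h : ℝ → ℂ := fun ξ => 𝓕 g ξ / (2 * π * Complex.I * ξ) with hdef
  have hGc : Continuous (𝓕 g) :=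
    VectorFourier.fourierIntegral_continuous Real.continuous_fourierChar continuous_inner hg
  have hmeas : AEStronglyMeasurable h := by
    refine Measurable.aestronglyMeasurable ?_
    have := hGc.measurable
    fun_prop
  have hmul : ∀ ξ : ℝ, (2 * π * Complex.I * ξ) * h ξ = 𝓕 g ξ := by
    intro ξ
    by_cases hξ : ξ = 0
    · subst hξ; simp [hsupp 0 hε]
    · have : (ξ : ℂ) ≠ 0 := by exact_mod_cast hξ
      simp only [hdef]
      field_simp
  have hi : Integrable h := by
    refine (hG.const_mul ((2 * π * ε : ℝ)⁻¹ : ℂ)).mono hmeas (Eventually.of_forall fun ξ => ?_)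
    rcases lt_or_ge ξ ε with hξ | hξ
    · simp [hdef, hsupp ξ hξ]
    · have hξ0 : 0 < ξ := hε.trans_le hξ
      simp only [hdef, norm_div, norm_mul, norm_inv, Complex.norm_real, Complex.norm_I,
        Complex.norm_ofNat, Real.norm_of_nonneg Real.pi_pos.le, Real.norm_of_nonneg hξ0.le,
        Real.norm_of_nonneg (show 0 ≤ 2 * π * ε by positivity), mul_one]
      rw [div_eq_inv_mul]
      gcongr
  have hi' : Integrable fun x : ℝ => x • h x := by
    refine (hG.const_mul ((2 * π * Complex.I)⁻¹ : ℂ)).congr (Eventually.of_forall fun ξ => ?_)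
    have : (2 * π * Complex.I : ℂ) ≠ 0 := by simp [Real.pi_ne_zero]
    simp only [← hmul, Complex.real_smul]
    field_simp
  refine ⟨hi, funext fun x => ?_⟩
  have hd : ∀ y, HasDerivAt (𝓕⁻ h) (g y) y := by
    intro y
    have h1 := hasDerivAt_fourierInv hi hi' y
    simp only [hmul] at h1
    have h2 : 𝓕⁻ (fun x => 𝓕 g x) y = g y := congrFun (hc.fourierInv_fourier_eq hg hG) y
    rwa [h2] at h1
  have h1 := integral_Iic_of_hasDerivAt_of_tendsto' (a := x) (fun y _ => hd y) hg.integrableOn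
    (tendsto_fourierInv_atBot h)
  have h0 : ∫ y, g y = 0 := by
    rw [← hsupp 0 hε, Real.fourier_real_eq]; simp
  have h2 : (∫ y in Iic x, g y) + ∫ y in Ioi x, g y = 0 := by
    rw [← h0]
    simpa using integral_add_compl (measurableSet_Iic (a := x)) hg
  rw [pinv, integral_Ici_eq_integral_Ioi, eq_neg_of_add_eq_zero_right h2, h1]
  ring

theorem sq_lintegral_mul_le {α : Type*} [MeasurableSpace α] {μ : Measure α} {f g : α → ℝ≥0∞}
    (hf : AEMeasurable f μ) (hg : AEMeasurable g μ) :
    (∫⁻ a, f a * g a ∂μ) ^ 2 ≤ (∫⁻ a, f a ^ 2 ∂μ) * ∫⁻ a, g a ^ 2 ∂μ := by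
  have h := ENNReal.lintegral_mul_le_Lp_mul_Lq μ Real.HolderConjugate.two_two hf hg
  simp only [Pi.mul_apply, ENNReal.rpow_two] at h
  calc (∫⁻ a, f a * g a ∂μ) ^ 2
      ≤ ((∫⁻ a, f a ^ 2 ∂μ) ^ (1 / 2 : ℝ) * (∫⁻ a, g a ^ 2 ∂μ) ^ (1 / 2 : ℝ)) ^ 2 := by gcongr
    _ = _ := by
      rw [mul_pow, ← ENNReal.rpow_two, ← ENNReal.rpow_two, ← ENNReal.rpow_mul, ← ENNReal.rpow_mul]
      norm_num

/-- Young's convolution inequality `L¹ * L² ⊆ L²`, squared. -/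
theorem lintegral_sq_conv_le {f g : ℝ → ℝ≥0∞} (hf : Measurable f) (hg : Measurable g) :
    ∫⁻ ξ, (∫⁻ η, f η * g (ξ - η)) ^ 2 ≤ (∫⁻ η, f η) ^ 2 * ∫⁻ ξ, g ξ ^ 2 := by
  have hpt : ∀ ξ, (∫⁻ η, f η * g (ξ - η)) ^ 2 ≤ (∫⁻ η, f η) * ∫⁻ η, f η * g (ξ - η) ^ 2 := by
    intro ξ
    have hgξ : Measurable fun η => g (ξ - η) := by fun_prop
    have h := sq_lintegral_mul_le (μ := volume) (f := fun η => f η ^ (1 / 2 : ℝ))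
      (g := fun η => f η ^ (1 / 2 : ℝ) * g (ξ - η)) (by fun_prop) (by fun_prop)
    have hsq : ∀ x : ℝ≥0∞, (x ^ (1 / 2 : ℝ)) ^ 2 = x := fun x => by
      rw [← ENNReal.rpow_two, ← ENNReal.rpow_mul]; norm_num
    simpa only [← mul_assoc, ← sq, mul_pow, hsq] using h
  calc ∫⁻ ξ, (∫⁻ η, f η * g (ξ - η)) ^ 2
      ≤ ∫⁻ ξ, (∫⁻ η, f η) * ∫⁻ η, f η * g (ξ - η) ^ 2 := lintegral_mono hpt
    _ = (∫⁻ η, f η) * ∫⁻ ξ, ∫⁻ η, f η * g (ξ - η) ^ 2 :=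
      lintegral_const_mul _ (Measurable.lintegral_prod_right' (f := fun p : ℝ × ℝ =>
        f p.2 * g (p.1 - p.2) ^ 2) (by fun_prop))
    _ = (∫⁻ η, f η) * ∫⁻ η, ∫⁻ ξ, f η * g (ξ - η) ^ 2 := by
      rw [lintegral_lintegral_swap]
      exact Measurable.aemeasurable (by unfold Function.uncurry; fun_prop)
    _ = (∫⁻ η, f η) * ∫⁻ η, f η * ∫⁻ ξ, g ξ ^ 2 := by
      congr 2 with η
      rw [lintegral_const_mul _ (by fun_prop), lintegral_sub_right_eq_self (fun ξ => g ξ ^ 2) η]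
    _ = _ := by
      rw [lintegral_mul_const _ hf, sq, mul_assoc]

theorem lintegral_conv_eq {f g : ℝ → ℝ≥0∞} (hf : Measurable f) (hg : Measurable g) :
    ∫⁻ ξ, ∫⁻ η, f η * g (ξ - η) = (∫⁻ η, f η) * ∫⁻ ξ, g ξ := by
  rw [lintegral_lintegral_swap
    (Measurable.aemeasurable (by unfold Function.uncurry; fun_prop))]
  rw [← lintegral_mul_const _ hf]
  congr 1 with η
  rw [lintegral_const_mul _ (by fun_prop), lintegral_sub_right_eq_self g η]

/-- The square root of the density in `Enorm`. -/
noncomputable def weight (s σ ξ : ℝ) : ℝ := (1 + ξ ^ 2) ^ (σ / 2) * (2 : ℝ) ^ (s * |ξ|)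

theorem weight_pos (s σ ξ : ℝ) : 0 < weight s σ ξ := by unfold weight; positivity

@[fun_prop]
theorem measurable_weight (s σ : ℝ) : Measurable (weight s σ) := by
  unfold weight
  fun_prop

theorem weight_sq (s σ ξ : ℝ) :
    weight s σ ξ ^ 2 = (1 + ξ ^ 2) ^ σ * (2 : ℝ) ^ (2 * s * |ξ|) := by
  rw [weight, mul_pow, ← Real.rpow_mul_natCast (by positivity),
    ← Real.rpow_mul_natCast (by norm_num)]
  congr 2 <;> push_cast <;> ring

theorem one_add_add_sq_le (a b : ℝ) : 1 + (a + b) ^ 2 ≤ 2 * ((1 + a ^ 2) * (1 + b ^ 2)) := by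
  nlinarith [sq_nonneg (a - b), sq_nonneg (a * b)]

theorem weight_add_le {s σ a b : ℝ} (hσ : 0 ≤ σ) (ha : 0 ≤ a) (hb : 0 ≤ b) :
    weight s σ (a + b) ≤ 2 ^ (σ / 2) * (weight s σ a * weight s σ b) := by
  have h1 : (1 + (a + b) ^ 2) ^ (σ / 2) ≤
      2 ^ (σ / 2) * ((1 + a ^ 2) ^ (σ / 2) * (1 + b ^ 2) ^ (σ / 2)) := by
    rw [← Real.mul_rpow (by positivity) (by positivity),
      ← Real.mul_rpow (by positivity) (by positivity)]
    exact Real.rpow_le_rpow (by positivity) (one_add_add_sq_le a b) (by positivity)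
  have h2 : (2 : ℝ) ^ (s * |a + b|) = 2 ^ (s * |a|) * 2 ^ (s * |b|) := by
    rw [abs_of_nonneg ha, abs_of_nonneg hb, abs_of_nonneg (add_nonneg ha hb), mul_add,
      Real.rpow_add two_pos]
  simp only [weight]
  rw [h2]
  calc _ ≤ 2 ^ (σ / 2) * ((1 + a ^ 2) ^ (σ / 2) * (1 + b ^ 2) ^ (σ / 2)) *
        (2 ^ (s * |a|) * 2 ^ (s * |b|)) := by gcongr
    _ = _ := by ring

/-- For some `γ > 1/2`, dividing by the frequency gains `⟨a⟩^{-γ} ⟨b⟩^{-γ}` on the weight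
at the sum of frequencies. -/
theorem exists_weight_div_le {σ ε : ℝ} (hσ : 0 < σ) (hε : 0 < ε) :
    ∃ γ > 1 / 2, ∃ C > 0, ∀ s a b : ℝ, ε ≤ a → ε ≤ b →
      weight s σ (a + b) / (2 * π * (a + b)) ≤
        C * (weight s (σ - γ) a * weight s (σ - γ) b) := by
  obtain ⟨γ, hγ, D, hD, hmain⟩ : ∃ γ > 1 / 2, ∃ D > 0, ∀ a b : ℝ, 0 ≤ a → 0 ≤ b →
      (1 + (a + b) ^ 2) ^ ((σ - 1) / 2) ≤
        D * ((1 + a ^ 2) * (1 + b ^ 2)) ^ ((σ - γ) / 2) := by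
    rcases le_total σ 1 with h | h
    · refine ⟨(1 + σ) / 2, by linarith, 1, one_pos, fun a b ha hb => ?_⟩
      rw [one_mul, show (σ - (1 + σ) / 2) / 2 = (1 / 2 : ℝ) * ((σ - 1) / 2) by ring,
        Real.rpow_mul (by positivity), ← Real.sqrt_eq_rpow]
      refine Real.rpow_le_rpow_of_nonpos (by positivity) ?_ (by linarith)
      refine Real.sqrt_le_iff.2 ⟨by positivity, ?_⟩
      rw [sq (1 + (a + b) ^ 2)]
      have := mul_nonneg ha hb
      gcongr <;> nlinarith [sq_nonneg a, sq_nonneg b]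
    · refine ⟨1, by norm_num, 2 ^ ((σ - 1) / 2), by positivity, fun a b _ _ => ?_⟩
      rw [← Real.mul_rpow (by positivity) (by positivity)]
      exact Real.rpow_le_rpow (by positivity) (one_add_add_sq_le a b) (by linarith)
  set K : ℝ := (1 + 1 / ε ^ 2) ^ (1 / 2 : ℝ) with hK
  have hKp : 0 < K := by positivity
  refine ⟨γ, hγ, K * D, by positivity, fun s a b ha hb => ?_⟩
  have ha0 : 0 < a := hε.trans_le ha
  have hb0 : 0 < b := hε.trans_le hb
  have hab : 0 < a + b := by positivity
  have hinv : 1 / (2 * π * (a + b)) ≤ K * (1 + (a + b) ^ 2) ^ (-(1 / 2) : ℝ) := by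
    have h1 : (1 + (a + b) ^ 2) ^ (1 / 2 : ℝ) ≤ K * (a + b) := by
      have : K * (a + b) = ((1 + 1 / ε ^ 2) * (a + b) ^ 2) ^ (1 / 2 : ℝ) := by
        rw [Real.mul_rpow (by positivity) (by positivity), ← Real.sqrt_eq_rpow (_ ^ 2),
          Real.sqrt_sq hab.le]
      rw [this]
      refine Real.rpow_le_rpow (by positivity) ?_ (by norm_num)
      have : 1 ≤ 1 / ε ^ 2 * (a + b) ^ 2 := by
        rw [one_div_mul_eq_div, one_le_div (by positivity)]
        gcongr
        linarith
      linarith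
    rw [Real.rpow_neg (by positivity), ← div_eq_mul_inv, div_le_div_iff₀ (by positivity)
      (by positivity), one_mul]
    refine h1.trans ?_
    gcongr
    nlinarith [Real.pi_gt_three]
  have h2 : (2 : ℝ) ^ (s * |a + b|) = 2 ^ (s * |a|) * 2 ^ (s * |b|) := by
    rw [abs_of_pos ha0, abs_of_pos hb0, abs_of_pos hab, mul_add, Real.rpow_add two_pos]
  calc weight s σ (a + b) / (2 * π * (a + b))
      = (1 + (a + b) ^ 2) ^ (σ / 2) * (2 ^ (s * |a|) * 2 ^ (s * |b|)) *
          (1 / (2 * π * (a + b))) := by rw [weight, h2]; ring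
    _ ≤ (1 + (a + b) ^ 2) ^ (σ / 2) * (2 ^ (s * |a|) * 2 ^ (s * |b|)) *
          (K * (1 + (a + b) ^ 2) ^ (-(1 / 2) : ℝ)) := by gcongr
    _ = K * (1 + (a + b) ^ 2) ^ ((σ - 1) / 2) * (2 ^ (s * |a|) * 2 ^ (s * |b|)) := by
      rw [show (σ - 1) / 2 = σ / 2 + -(1 / 2) by ring, Real.rpow_add (by positivity)]
      ring
    _ ≤ K * (D * ((1 + a ^ 2) * (1 + b ^ 2)) ^ ((σ - γ) / 2)) *
          (2 ^ (s * |a|) * 2 ^ (s * |b|)) := by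
      gcongr
      exact hmain a b ha0.le hb0.le
    _ = _ := by
      rw [Real.mul_rpow (by positivity) (by positivity), weight, weight]
      ring

/-- The square of the weighted `L²` norm of `F`, as an extended nonnegative real. -/
noncomputable def weightedSq (s σ : ℝ) (F : ℝ → ℂ) : ℝ≥0∞ :=
  ∫⁻ ξ, (ENNReal.ofReal (weight s σ ξ) * ‖F ξ‖ₑ) ^ 2

theorem continuous_fourier {f : ℝ → ℂ} (hf : Integrable f) : Continuous (𝓕 f) :=
  VectorFourier.fourierIntegral_continuous Real.continuous_fourierChar continuous_inner hf

theorem ofReal_weight_sq_mul (s σ ξ : ℝ) (z : ℂ) :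
    (ENNReal.ofReal (weight s σ ξ) * ‖z‖ₑ) ^ 2 =
      ENNReal.ofReal ((1 + ξ ^ 2) ^ σ * (2 : ℝ) ^ (2 * s * |ξ|) * ‖z‖ ^ 2) := by
  rw [← weight_sq, ← mul_pow, ENNReal.ofReal_pow (mul_nonneg (weight_pos s σ ξ).le (norm_nonneg z)),
    ENNReal.ofReal_mul (weight_pos s σ ξ).le, ofReal_norm]

theorem Enorm_eq {s σ : ℝ} {f : ℝ → ℂ} (hf : Integrable f) :
    Enorm s σ f = (weightedSq s σ (𝓕 f)).toReal ^ (1 / 2 : ℝ) := by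
  have hm : Measurable (𝓕 f) := (continuous_fourier hf).measurable
  rw [Enorm, integral_eq_lintegral_of_nonneg_ae (Eventually.of_forall fun ξ => by positivity)
    (Measurable.aestronglyMeasurable (by fun_prop))]
  simp only [weightedSq, ofReal_weight_sq_mul]

theorem norm_fourierInv_le (h : ℝ → ℂ) (x : ℝ) : ‖𝓕⁻ h x‖ ≤ ∫ ξ, ‖h ξ‖ :=
  VectorFourier.norm_fourierIntegral_le_integral_norm _ _ _ _ _

theorem integrable_mul_fourierInv {φ h : ℝ → ℂ} (hφ : Integrable φ) (hh : Integrable h) :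
    Integrable fun x => φ x * 𝓕⁻ h x := by
  refine hφ.mul_bdd ?_ (Eventually.of_forall (norm_fourierInv_le h))
  rw [Real.fourierInv_eq_fourier_comp_neg]
  exact (continuous_fourier hh.comp_neg).aestronglyMeasurable

theorem weightedSq_fourier_mul_le {s σ : ℝ} (hσ : 0 ≤ σ) {φ h : ℝ → ℂ} (hφ : Integrable φ)
    (hh : Integrable h) (hhm : Measurable h) (hφs : ∀ ξ < 0, 𝓕 φ ξ = 0)
    (hhs : ∀ ξ < 0, h ξ = 0) :
    weightedSq s σ (𝓕 (fun x => φ x * 𝓕⁻ h x)) ≤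
      (ENNReal.ofReal (2 ^ (σ / 2)) * ∫⁻ ξ, ENNReal.ofReal (weight s σ ξ) * ‖h ξ‖ₑ) ^ 2 *
        weightedSq s σ (𝓕 φ) := by
  have hm : Measurable (𝓕 φ) := (continuous_fourier hφ).measurable
  have hpt : ∀ ξ, ENNReal.ofReal (weight s σ ξ) * ‖𝓕 (fun x => φ x * 𝓕⁻ h x) ξ‖ₑ ≤
      ∫⁻ η, (ENNReal.ofReal (2 ^ (σ / 2)) * (ENNReal.ofReal (weight s σ η) * ‖h η‖ₑ)) *
        (ENNReal.ofReal (weight s σ (ξ - η)) * ‖𝓕 φ (ξ - η)‖ₑ) := by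
    intro ξ
    rw [fourier_mul_fourierInv hφ hh]
    refine (mul_le_mul_right (enorm_integral_le_lintegral_enorm _) _).trans ?_
    rw [← lintegral_const_mul _ (by fun_prop)]
    refine lintegral_mono fun η => ?_
    rcases lt_or_ge η 0 with hη | hη
    · simp [hhs η hη]
    rcases lt_or_ge (ξ - η) 0 with hη' | hη'
    · simp [hφs _ hη']
    have hw := weight_add_le (s := s) hσ hη hη'
    rw [add_sub_cancel] at hw
    calc ENNReal.ofReal (weight s σ ξ) * ‖h η * 𝓕 φ (ξ - η)‖ₑ
        ≤ ENNReal.ofReal (2 ^ (σ / 2) * (weight s σ η * weight s σ (ξ - η))) *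
          ‖h η * 𝓕 φ (ξ - η)‖ₑ := by gcongr
      _ = _ := by
        rw [ENNReal.ofReal_mul (by positivity), ENNReal.ofReal_mul (weight_pos _ _ _).le,
          enorm_mul]
        ring
  calc weightedSq s σ (𝓕 (fun x => φ x * 𝓕⁻ h x)) ≤ _ :=
        lintegral_mono fun ξ => pow_le_pow_left' (hpt ξ) 2
    _ ≤ _ := lintegral_sq_conv_le
        (f := fun η => ENNReal.ofReal (2 ^ (σ / 2)) * (ENNReal.ofReal (weight s σ η) * ‖h η‖ₑ))
        (g := fun η => ENNReal.ofReal (weight s σ η) * ‖𝓕 φ η‖ₑ) (by fun_prop) (by fun_prop)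
    _ = _ := by
      rw [lintegral_const_mul _ (by fun_prop)]
      rfl

theorem weight_sub (s σ γ ξ : ℝ) :
    weight s (σ - γ) ξ = (1 + ξ ^ 2) ^ (-γ / 2) * weight s σ ξ := by
  rw [weight, weight, show (σ - γ) / 2 = -γ / 2 + σ / 2 by ring, Real.rpow_add (by positivity),
    mul_assoc]

theorem sq_lintegral_weight_sub_le (s σ γ : ℝ) {U : ℝ → ℂ} (hU : Measurable U) :
    (∫⁻ ξ, ENNReal.ofReal (weight s (σ - γ) ξ) * ‖U ξ‖ₑ) ^ 2 ≤
      (∫⁻ ξ : ℝ, ENNReal.ofReal ((1 + ξ ^ 2) ^ (-γ))) * weightedSq s σ U := by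
  have h := sq_lintegral_mul_le (μ := volume)
    (f := fun ξ : ℝ => ENNReal.ofReal ((1 + ξ ^ 2) ^ (-γ / 2)))
    (g := fun ξ => ENNReal.ofReal (weight s σ ξ) * ‖U ξ‖ₑ) (by fun_prop) (by fun_prop)
  have h1 : ∀ ξ : ℝ, ENNReal.ofReal ((1 + ξ ^ 2) ^ (-γ / 2)) ^ 2 =
      ENNReal.ofReal ((1 + ξ ^ 2) ^ (-γ)) := by
    intro ξ
    rw [← ENNReal.ofReal_pow (by positivity), ← Real.rpow_mul_natCast (by positivity)]
    congr 2
    push_cast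
    ring
  simp only [h1, ← mul_assoc] at h
  simp only [weight_sub]
  rw [weightedSq]
  convert h using 4 with ξ
  rw [ENNReal.ofReal_mul (by positivity)]

theorem lintegral_one_add_sq_rpow_lt_top {γ : ℝ} (hγ : 1 / 2 < γ) :
    ∫⁻ ξ : ℝ, ENNReal.ofReal ((1 + ξ ^ 2) ^ (-γ)) < ∞ := by
  have h := integrable_rpow_neg_one_add_norm_sq (E := ℝ) (μ := volume) (r := 2 * γ)
    (by simp; linarith)
  convert h.lintegral_lt_top using 5 with ξ
  · simp
  · ring

theorem star_comp_neg_eq_fourierInv (u : SchwartzMap ℝ ℂ) (x : ℝ) :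
    (starRingEnd ℂ) (u (-x)) = 𝓕⁻ (fun η => (starRingEnd ℂ) (𝓕 (⇑u) η)) x := by
  have h1 : u (-x) = 𝓕 (𝓕 (⇑u)) x := by
    have := congrFun (u.continuous.fourierInv_fourier_eq u.integrable (𝓕 u).integrable) (-x)
    rw [← this, Real.fourierInv_eq_fourier_neg, neg_neg]
  rw [h1, Real.fourier_eq, Real.fourierInv_eq, ← integral_conj]
  refine integral_congr_ae (Eventually.of_forall fun y => ?_)
  simp [Circle.smul_def, AddChar.map_neg_eq_inv]

theorem integrable_conj_fourier (u : SchwartzMap ℝ ℂ) :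
    Integrable fun η => (starRingEnd ℂ) (𝓕 (⇑u) η) :=
  (LinearIsometryEquiv.integrable_comp_iff Complex.conjLIE).2 (𝓕 u).integrable

theorem fourier_mul_star_eq (u : SchwartzMap ℝ ℂ) (ξ : ℝ) :
    𝓕 (fun y => u y * (starRingEnd ℂ) (u (-y))) ξ =
      ∫ η, (starRingEnd ℂ) (𝓕 (⇑u) η) * 𝓕 (⇑u) (ξ - η) := by
  simp only [star_comp_neg_eq_fourierInv]
  exact fourier_mul_fourierInv u.integrable (integrable_conj_fourier u) ξ

theorem integrable_mul_star (u : SchwartzMap ℝ ℂ) :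
    Integrable fun y => u y * (starRingEnd ℂ) (u (-y)) := by
  simp only [star_comp_neg_eq_fourierInv]
  exact integrable_mul_fourierInv u.integrable (integrable_conj_fourier u)

theorem integrable_fourier_mul_star (u : SchwartzMap ℝ ℂ) :
    Integrable (𝓕 (fun y => u y * (starRingEnd ℂ) (u (-y)))) := by
  have h2 := (integrable_conj_fourier u).integrable_convolution
    (ContinuousLinearMap.mul ℂ ℂ) (𝓕 u).integrable
  convert h2 using 1
  ext ξ
  rw [fourier_mul_star_eq]
  rfl

theorem lintegral_weight_mul_div_le {s σ γ C ε : ℝ} (hε : 0 < ε)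
    (hC : 0 < C) (hker : ∀ a b : ℝ, ε ≤ a → ε ≤ b →
      weight s σ (a + b) / (2 * π * (a + b)) ≤
        C * (weight s (σ - γ) a * weight s (σ - γ) b))
    {U G : ℝ → ℂ} (hU : Measurable U) (hUs : ∀ ξ < ε, U ξ = 0)
    (hG : ∀ ξ, G ξ = ∫ η, (starRingEnd ℂ) (U η) * U (ξ - η)) :
    ∫⁻ ξ, ENNReal.ofReal (weight s σ ξ) * ‖G ξ / (2 * π * Complex.I * ξ)‖ₑ ≤
      ENNReal.ofReal C * (∫⁻ ξ, ENNReal.ofReal (weight s (σ - γ) ξ) * ‖U ξ‖ₑ) ^ 2 := by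
  have hUc : Measurable fun η => (starRingEnd ℂ) (U η) :=
    Complex.continuous_conj.measurable.comp hU
  have hpt : ∀ ξ : ℝ, ENNReal.ofReal (weight s σ ξ) * ‖G ξ / (2 * π * Complex.I * ξ)‖ₑ ≤
      ∫⁻ η, (ENNReal.ofReal C * (ENNReal.ofReal (weight s (σ - γ) η) * ‖U η‖ₑ)) *
        (ENNReal.ofReal (weight s (σ - γ) (ξ - η)) * ‖U (ξ - η)‖ₑ) := by
    intro ξ
    rw [div_eq_mul_inv, enorm_mul, mul_comm ‖G ξ‖ₑ, ← mul_assoc, hG]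
    refine (mul_le_mul_right (enorm_integral_le_lintegral_enorm _) _).trans ?_
    rw [← lintegral_const_mul _ (by fun_prop)]
    refine lintegral_mono fun η => ?_
    rcases lt_or_ge η ε with hη | hη
    · simp [hUs η hη]
    rcases lt_or_ge (ξ - η) ε with hη' | hη'
    · simp [hUs _ hη']
    have hw := hker _ _ hη hη'
    rw [add_sub_cancel] at hw
    have hξ : 0 < ξ := by linarith
    have hinv : ‖(2 * π * Complex.I * ξ : ℂ)⁻¹‖ₑ = ENNReal.ofReal (2 * π * ξ)⁻¹ := by
      rw [← ofReal_norm]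
      simp [abs_of_pos Real.pi_pos, abs_of_pos hξ]
    rw [hinv, ← ENNReal.ofReal_mul (weight_pos _ _ _).le, ← div_eq_mul_inv]
    calc _ ≤ ENNReal.ofReal (C * (weight s (σ - γ) η * weight s (σ - γ) (ξ - η))) *
          ‖(starRingEnd ℂ) (U η) * U (ξ - η)‖ₑ := by gcongr
      _ = _ := by
        rw [ENNReal.ofReal_mul hC.le, ENNReal.ofReal_mul (weight_pos _ _ _).le,
          enorm_mul, RCLike.enorm_conj]
        ring
  calc _ ≤ _ := lintegral_mono hpt
    _ = _ := lintegral_conv_eq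
        (f := fun η => ENNReal.ofReal C * (ENNReal.ofReal (weight s (σ - γ) η) * ‖U η‖ₑ))
        (g := fun η => ENNReal.ofReal (weight s (σ - γ) η) * ‖U η‖ₑ) (by fun_prop) (by fun_prop)
    _ = _ := by
      rw [lintegral_const_mul _ (by fun_prop), sq, mul_assoc]

theorem weightedSq_schwartz_lt_top {s σ : ℝ} (hs : s ≤ 0) (f : SchwartzMap ℝ ℂ) :
    weightedSq s σ f < ∞ := by
  obtain ⟨n, hn⟩ := exists_nat_ge (σ + 1)
  set M : ℝ := 2 ^ n * (Finset.Iic (n, 0)).sup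
    (fun m => SchwartzMap.seminorm ℝ (E := ℝ) (F := ℂ) m.1 m.2) f
  have hM : ∀ ξ, (1 + |ξ|) ^ n * ‖f ξ‖ ≤ M := fun ξ => by
    simpa using SchwartzMap.one_add_le_sup_seminorm_apply (𝕜 := ℝ) (m := (n, 0)) (k := n)
      (n := 0) le_rfl le_rfl f ξ
  have hint : ∫⁻ ξ : ℝ, ENNReal.ofReal (M ^ 2) * ENNReal.ofReal ((1 + ξ ^ 2) ^ (-1 : ℝ)) < ∞ := by
    rw [lintegral_const_mul _ (by fun_prop)]
    exact ENNReal.mul_lt_top ENNReal.ofReal_lt_top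
      (lintegral_one_add_sq_rpow_lt_top (by norm_num))
  refine (lintegral_mono fun ξ => ?_).trans_lt hint
  rw [ofReal_weight_sq_mul, ← ENNReal.ofReal_mul (by positivity)]
  refine ENNReal.ofReal_le_ofReal ?_
  have h2 : (2 : ℝ) ^ (2 * s * |ξ|) ≤ 1 :=
    Real.rpow_le_one_of_one_le_of_nonpos one_le_two
      (mul_nonpos_of_nonpos_of_nonneg (by linarith) (abs_nonneg _))
  have h3 : (1 + ξ ^ 2) ^ σ ≤ (1 + ξ ^ 2) ^ (-1 : ℝ) * ((1 + |ξ|) ^ n) ^ 2 := by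
    have h4 : (1 + ξ ^ 2) ^ (σ + 1) ≤ (1 + ξ ^ 2) ^ (n : ℝ) :=
      Real.rpow_le_rpow_of_exponent_le (by nlinarith [sq_nonneg ξ]) hn
    have h5 : 1 + ξ ^ 2 ≤ (1 + |ξ|) ^ 2 := by nlinarith [sq_abs ξ, abs_nonneg ξ]
    rw [show σ = -1 + (σ + 1) by ring, Real.rpow_add (by positivity)]
    gcongr
    refine h4.trans ?_
    rw [Real.rpow_natCast, ← pow_mul, mul_comm, pow_mul]
    gcongr
  calc (1 + ξ ^ 2) ^ σ * (2 : ℝ) ^ (2 * s * |ξ|) * ‖f ξ‖ ^ 2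
      ≤ ((1 + ξ ^ 2) ^ (-1 : ℝ) * ((1 + |ξ|) ^ n) ^ 2) * 1 * ‖f ξ‖ ^ 2 := by gcongr
    _ = ((1 + |ξ|) ^ n * ‖f ξ‖) ^ 2 * (1 + ξ ^ 2) ^ (-1 : ℝ) := by ring
    _ ≤ _ := by gcongr; exact hM ξ

theorem weightedSq_fourier_mul_pow_le {s σ : ℝ} (hσ : 0 ≤ σ) {φ h : ℝ → ℂ} (hφ : Integrable φ)
    (hh : Integrable h) (hhm : Measurable h) (hφs : ∀ ξ < 0, 𝓕 φ ξ = 0)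
    (hhs : ∀ ξ < 0, h ξ = 0) (k : ℕ) :
    Integrable (fun x => φ x * 𝓕⁻ h x ^ k) ∧ (∀ ξ < 0, 𝓕 (fun x => φ x * 𝓕⁻ h x ^ k) ξ = 0) ∧
    weightedSq s σ (𝓕 (fun x => φ x * 𝓕⁻ h x ^ k)) ≤
      ((ENNReal.ofReal (2 ^ (σ / 2)) * ∫⁻ ξ, ENNReal.ofReal (weight s σ ξ) * ‖h ξ‖ₑ) ^ 2) ^ k *
        weightedSq s σ (𝓕 φ) := by
  induction k with
  | zero => simpa using ⟨hφ, hφs⟩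
  | succ k ih =>
    obtain ⟨ih1, ih2, ih3⟩ := ih
    simp only [pow_succ _ k, ← mul_assoc]
    refine ⟨integrable_mul_fourierInv ih1 hh, fun ξ hξ => ?_, ?_⟩
    · rw [fourier_mul_fourierInv ih1 hh]
      refine integral_eq_zero_of_ae (Eventually.of_forall fun η => ?_)
      rcases lt_or_ge η 0 with hη | hη
      · simp [hhs η hη]
      · simp [ih2 (ξ - η) (by linarith)]
    · refine (weightedSq_fourier_mul_le hσ ih1 hh hhm ih2 hhs).trans ?_
      rw [mul_comm (_ ^ k), mul_assoc]
      gcongr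

/-- For `σ > 0`, `ε₀ > 0`, there is `C > 0` such that for all `s ≤ 0`, `k ∈ ℕ`, and Schwartz
`u` with `supp 𝓕u ⊆ [ε₀, ∞)`: `‖u (∂ₓ⁻¹(u u*))^k‖_{E^s_σ} ≤ C^k ‖u‖^{2k+1}_{E^s_σ}`. -/
theorem stmt_11 (σ ε₀ : ℝ) (hσ : 0 < σ) (hε : 0 < ε₀) :
    ∃ C > 0, ∀ s ≤ (0 : ℝ), ∀ k : ℕ, ∀ u : SchwartzMap ℝ ℂ,
      Function.support (𝓕 ⇑u) ⊆ Set.Ici ε₀ →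
      Enorm s σ (fun x => u x * (pinv (fun y => u y * (starRingEnd ℂ) (u (-y))) x) ^ k)
        ≤ C ^ k * Enorm s σ ⇑u ^ (2 * k + 1) := by
  obtain ⟨γ, hγ, D, hD, hker⟩ := exists_weight_div_le hσ hε
  set A : ℝ≥0∞ := ∫⁻ ξ : ℝ, ENNReal.ofReal ((1 + ξ ^ 2) ^ (-γ)) with hA
  have hAt : A < ∞ := lintegral_one_add_sq_rpow_lt_top hγ
  set B : ℝ≥0∞ := ENNReal.ofReal (2 ^ (σ / 2)) * (ENNReal.ofReal D * A) with hB
  have hBt : B ≠ ∞ := by finiteness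
  refine ⟨B.toReal + 1, by positivity, fun s hs k u hu => ?_⟩
  set U : ℝ → ℂ := 𝓕 ⇑u with hUdef
  have hUs : ∀ ξ < ε₀, U ξ = 0 := fun ξ hξ => by
    by_contra h
    exact absurd (hu h) (not_le.2 hξ)
  have hUm : Measurable U := (continuous_fourier u.integrable).measurable
  set g : ℝ → ℂ := fun y => u y * (starRingEnd ℂ) (u (-y)) with hg
  have hgc : Continuous g :=
    u.continuous.mul (Complex.continuous_conj.comp (u.continuous.comp continuous_neg))
  have hGs : ∀ ξ < ε₀, 𝓕 g ξ = 0 := by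
    intro ξ hξ
    rw [hg, fourier_mul_star_eq]
    refine integral_eq_zero_of_ae (Eventually.of_forall fun η => ?_)
    rcases lt_or_ge η ε₀ with hη | hη
    · simp [← hUdef, hUs η hη]
    · simp [← hUdef, hUs (ξ - η) (by linarith)]
  obtain ⟨hhi, hv⟩ := pinv_eq_fourierInv hgc (integrable_mul_star u)
    (integrable_fourier_mul_star u) hε hGs
  set h : ℝ → ℂ := fun ξ => 𝓕 g ξ / (2 * π * Complex.I * ξ) with hh
  have hhm : Measurable h := by
    have : Measurable (𝓕 g) := (continuous_fourier (integrable_mul_star u)).measurable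
    fun_prop
  obtain ⟨hint, -, hle⟩ := weightedSq_fourier_mul_pow_le (s := s) hσ.le u.integrable hhi hhm
    (fun ξ hξ => hUs ξ (hξ.trans hε)) (fun ξ hξ => by simp [hh, hGs ξ (hξ.trans hε)]) k
  set N := weightedSq s σ U
  have hNt : N ≠ ∞ := (weightedSq_schwartz_lt_top hs (𝓕 u)).ne
  have hbound : ENNReal.ofReal (2 ^ (σ / 2)) *
      ∫⁻ ξ, ENNReal.ofReal (weight s σ ξ) * ‖h ξ‖ₑ ≤ B * N := by
    rw [hB, mul_assoc, mul_assoc]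
    gcongr
    exact (lintegral_weight_mul_div_le hε hD (hker s) hUm hUs (fourier_mul_star_eq u)).trans
      (mul_le_mul_right (sq_lintegral_weight_sub_le s σ γ hUm) _)
  have hle' : weightedSq s σ (𝓕 (fun x => u x * 𝓕⁻ h x ^ k)) ≤ ((B * N) ^ 2) ^ k * N :=
    hle.trans (by gcongr)
  rw [hv, Enorm_eq hint, Enorm_eq u.integrable, ← Real.sqrt_eq_rpow, ← Real.sqrt_eq_rpow]
  have hN : √N.toReal ^ 2 = N.toReal := Real.sq_sqrt ENNReal.toReal_nonneg
  refine Real.sqrt_le_iff.2 ⟨by positivity, ?_⟩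
  calc _ ≤ (((B * N) ^ 2) ^ k * N).toReal := ENNReal.toReal_mono (by finiteness) hle'
    _ = (B.toReal ^ k * √N.toReal ^ (2 * k + 1)) ^ 2 := by
      have : (B.toReal ^ k * √N.toReal ^ (2 * k + 1)) ^ 2 =
          ((B.toReal * √N.toReal ^ 2) ^ 2) ^ k * √N.toReal ^ 2 := by ring
      rw [this, hN]
      simp
    _ ≤ _ := by
      gcongr
      linarith
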